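/- There exists a constant C > 0 such that for every ε, δ ∈ (0, 1/2] there exists an odd real polynomial p of degree at most C · (1/δ) · log(1/ε) satisfying: (i) |p(x) − (3/4)·(δ/x)| ≤ ε for all real x with δ ≤ |x| ≤ 1, and (ii) |p(x)| ≤ 1 for all x ∈ [−1, 1]. -/

import Mathlib

open Polynomial in
/-- normalized Dirichlet kernel, as a polynomial in `sin θ` -/
noncomputable def dirG (m : ℕ) : Polynomial ℝ :=
  C (1 / (2 * (m : ℝ) + 1)) *
    (1 + 2 * ∑ j ∈ Finset.range m, (Polynomial.Chebyshev.T ℝ ((j + 1 : ℕ) : ℤ)).comp (1 - 2 * X ^ 2))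

/-- upper tail of the binomial distribution -/
noncomputable def tailB (M : ℕ) : Polynomial ℝ :=
  ∑ i ∈ Finset.Icc M (2 * M), bernsteinPolynomial ℝ (2 * M) i

open Polynomial in
lemma dirG_eval (m : ℕ) (t : ℝ) : (dirG m).eval (Real.sin t) =
    (1 / (2 * (m : ℝ) + 1)) *
      (1 + 2 * ∑ j ∈ Finset.range m, Real.cos ((j + 1 : ℕ) * (2 * t))) := by
  have h : ∀ j : ℕ, (Polynomial.Chebyshev.T ℝ ((j + 1 : ℕ) : ℤ)).eval (1 - 2 * Real.sin t ^ 2)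
      = Real.cos ((j + 1 : ℕ) * (2 * t)) := by
    intro j
    have h1 : 1 - 2 * Real.sin t ^ 2 = Real.cos (2 * t) := by
      rw [Real.cos_two_mul, Real.cos_sq']; ring
    rw [h1, Polynomial.Chebyshev.T_real_cos]
    push_cast; rfl
  have h' : ∀ j : ℕ, ((Polynomial.Chebyshev.T ℝ ((j + 1 : ℕ) : ℤ)).comp (1 - 2 * X ^ 2)).eval
      (Real.sin t) = Real.cos ((j + 1 : ℕ) * (2 * t)) := by
    intro j
    rw [← h j, eval_comp]
    simp
  unfold dirG
  rw [eval_mul, eval_C, eval_add, eval_mul, eval_finsetSum, Finset.sum_congr rfl (fun j _ => h' j)]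
  simp

lemma dirSum (m : ℕ) (t : ℝ) :
    Real.sin t * (1 + 2 * ∑ j ∈ Finset.range m, Real.cos ((j + 1 : ℕ) * (2 * t))) =
      Real.sin ((2 * m + 1) * t) := by
  induction m with
  | zero => simp
  | succ k ih =>
    rw [Finset.sum_range_succ]
    have e1 : (2 * ((k + 1 : ℕ) : ℝ) + 1) * t = ((k + 1 : ℕ) : ℝ) * (2 * t) + t := by ring
    have e2 : (2 * (k : ℝ) + 1) * t = ((k + 1 : ℕ) : ℝ) * (2 * t) - t := by push_cast; ring
    rw [e2, Real.sin_sub] at ih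
    rw [e1, Real.sin_add]
    linear_combination ih

lemma abs_sin_nat (j : ℕ) (t : ℝ) : |Real.sin (j * t)| ≤ j * |Real.sin t| := by
  induction j with
  | zero => simp
  | succ k ih =>
    have e : ((k + 1 : ℕ) : ℝ) * t = k * t + t := by push_cast; ring
    rw [e, Real.sin_add]
    have h1 := Real.abs_cos_le_one t
    have h2 := Real.abs_cos_le_one (k * t)
    calc |Real.sin (k * t) * Real.cos t + Real.cos (k * t) * Real.sin t|
        ≤ |Real.sin (k * t)| * |Real.cos t| + |Real.cos (k * t)| * |Real.sin t| := by
          rw [← abs_mul, ← abs_mul]; exact abs_add_le _ _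
      _ ≤ |Real.sin (k * t)| * 1 + 1 * |Real.sin t| := by gcongr
      _ ≤ _ := by push_cast; linarith

lemma sum_sq (m : ℕ) : ∑ j ∈ Finset.range m, ((j + 1 : ℕ) : ℝ) ^ 2 =
    (m : ℝ) * (m + 1) * (2 * m + 1) / 6 := by
  induction m with
  | zero => simp
  | succ k ih => rw [Finset.sum_range_succ, ih]; push_cast; ring

lemma dirG_facts (m : ℕ) (y : ℝ) (hy : |y| ≤ 1) :
    (dirG m).eval y ^ 2 ≤ 1 ∧
    (dirG m).eval y ^ 2 * ((2 * m + 1) * y) ^ 2 ≤ 1 ∧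
    1 - (dirG m).eval y ^ 2 ≤ ((2 * m + 1) * y) ^ 2 / 3 := by
  obtain ⟨h1, h2⟩ := abs_le.1 hy
  obtain ⟨t, rfl⟩ : ∃ t, Real.sin t = y := ⟨Real.arcsin y, Real.sin_arcsin h1 h2⟩
  have hn : (0 : ℝ) < 2 * m + 1 := by positivity
  set g := (dirG m).eval (Real.sin t) with hg
  have hgn : (2 * m + 1) * g =
      1 + 2 * ∑ j ∈ Finset.range m, Real.cos ((j + 1 : ℕ) * (2 * t)) := by
    rw [hg, dirG_eval, ← mul_assoc, mul_one_div_cancel hn.ne', one_mul]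
  have hs : ∑ j ∈ Finset.range m, Real.cos ((j + 1 : ℕ) * (2 * t)) =
      m - 2 * ∑ j ∈ Finset.range m, Real.sin ((j + 1 : ℕ) * t) ^ 2 := by
    rw [Finset.mul_sum]
    have : (m : ℝ) = ∑ j ∈ Finset.range m, (1 : ℝ) := by simp
    rw [this, ← Finset.sum_sub_distrib]
    refine Finset.sum_congr rfl fun j _ => ?_
    have e : ((j + 1 : ℕ) : ℝ) * (2 * t) = 2 * (((j + 1 : ℕ) : ℝ) * t) := by ring
    rw [e, Real.cos_two_mul, Real.cos_sq']; ring
  have hq : ∑ j ∈ Finset.range m, Real.sin ((j + 1 : ℕ) * t) ^ 2 ≤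
      (m : ℝ) * (m + 1) * (2 * m + 1) / 6 * Real.sin t ^ 2 := by
    rw [← sum_sq, Finset.sum_mul]
    refine Finset.sum_le_sum fun j _ => ?_
    rw [← mul_pow]
    apply sq_le_sq.2
    rw [abs_mul, Nat.abs_cast]
    exact abs_sin_nat _ _
  have hq0 : 0 ≤ ∑ j ∈ Finset.range m, Real.sin ((j + 1 : ℕ) * t) ^ 2 :=
    Finset.sum_nonneg fun j _ => sq_nonneg _
  have hq1 : ∑ j ∈ Finset.range m, Real.sin ((j + 1 : ℕ) * t) ^ 2 ≤ m := by
    calc _ ≤ ∑ j ∈ Finset.range m, (1 : ℝ) :=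
          Finset.sum_le_sum fun j _ => Real.sin_sq_le_one _
      _ = m := by simp
  set Q := ∑ j ∈ Finset.range m, Real.sin ((j + 1 : ℕ) * t) ^ 2
  rw [hs] at hgn
  have hg1 : g ≤ 1 := by
    by_contra! h
    nlinarith
  have hg2 : -1 ≤ g := by
    by_contra! h
    nlinarith
  refine ⟨by nlinarith, ?_, ?_⟩
  · have : g * ((2 * m + 1) * Real.sin t) = Real.sin ((2 * m + 1) * t) := by
      rw [← dirSum, hs]; linear_combination Real.sin t * hgn
    rw [← mul_pow, this]; exact Real.sin_sq_le_one _
  · have h3 : (2 * m + 1) * (1 - g) ≤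
        (2 * m + 1) * (2 / 3 * (m * (m + 1)) * Real.sin t ^ 2) := by nlinarith
    have h4 := le_of_mul_le_mul_left h3 hn
    nlinarith [sq_nonneg (Real.sin t), sq_nonneg (1 - g)]

lemma dirG_zero (m : ℕ) : (dirG m).eval 0 ^ 2 = 1 := by
  have := dirG_facts m 0 (by simp)
  nlinarith [this.1, this.2.2]

lemma dirG_even (m : ℕ) (y : ℝ) : (dirG m).eval (-y) = (dirG m).eval y := by
  simp [dirG, Polynomial.eval_finsetSum]

open Polynomial in
lemma dirG_deg (m : ℕ) : (dirG m).natDegree ≤ 2 * m := by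
  unfold dirG
  refine (natDegree_C_mul_le _ _).trans ?_
  refine natDegree_add_le_of_degree_le (by simp) ?_
  have : (2 : ℝ[X]) = C 2 := (map_ofNat C 2).symm
  rw [this]
  refine (natDegree_C_mul_le _ _).trans ?_
  refine natDegree_sum_le_of_forall_le _ _ fun j hj => ?_
  refine natDegree_comp_le.trans ?_
  have h1 : (1 - C 2 * X ^ 2 : ℝ[X]).natDegree ≤ 2 := by compute_degree
  have h2 : (Polynomial.Chebyshev.T ℝ ((j + 1 : ℕ) : ℤ)).natDegree ≤ m := by
    rw [Polynomial.Chebyshev.natDegree_T]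
    have := Finset.mem_range.1 hj
    omega
  calc _ ≤ m * 2 := Nat.mul_le_mul h2 h1
    _ = _ := by ring

lemma bern_eval (n i : ℕ) (s : ℝ) : (bernsteinPolynomial ℝ n i).eval s =
    n.choose i * s ^ i * (1 - s) ^ (n - i) := by
  simp [bernsteinPolynomial]

lemma bern_nonneg (n i : ℕ) (s : ℝ) (h0 : 0 ≤ s) (h1 : s ≤ 1) :
    0 ≤ (bernsteinPolynomial ℝ n i).eval s := by
  rw [bern_eval]
  have : 0 ≤ 1 - s := by linarith
  positivity

lemma tail_split (M : ℕ) (s : ℝ) : (tailB M).eval s +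
    ∑ i ∈ Finset.range M, (bernsteinPolynomial ℝ (2 * M) i).eval s = 1 := by
  have h := congrArg (Polynomial.eval s) (bernsteinPolynomial.sum ℝ (2 * M))
  rw [Polynomial.eval_finsetSum, Polynomial.eval_one] at h
  rw [← h, tailB, Polynomial.eval_finsetSum, add_comm]
  have e : Finset.Icc M (2 * M) = Finset.Ico M (2 * M + 1) := by ext; simp only [Finset.mem_Icc, Finset.mem_Ico]; omega
  rw [e]
  exact Finset.sum_range_add_sum_Ico _ (by omega)

lemma tail_nonneg (M : ℕ) (s : ℝ) (h0 : 0 ≤ s) (h1 : s ≤ 1) : 0 ≤ (tailB M).eval s := by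
  rw [tailB, Polynomial.eval_finsetSum]
  exact Finset.sum_nonneg fun i _ => bern_nonneg _ _ _ h0 h1

lemma tail_le_one (M : ℕ) (s : ℝ) (h0 : 0 ≤ s) (h1 : s ≤ 1) : (tailB M).eval s ≤ 1 := by
  have h := tail_split M s
  have : 0 ≤ ∑ i ∈ Finset.range M, (bernsteinPolynomial ℝ (2 * M) i).eval s :=
    Finset.sum_nonneg fun i _ => bern_nonneg _ _ _ h0 h1
  linarith

lemma tail_markov (M : ℕ) (hM : 0 < M) (s : ℝ) (h0 : 0 ≤ s) (h1 : s ≤ 1) :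
    (tailB M).eval s ≤ 2 * s := by
  have h := congrArg (Polynomial.eval s) (bernsteinPolynomial.sum_smul ℝ (2 * M))
  rw [Polynomial.eval_finsetSum] at h
  simp only [nsmul_eq_mul, Polynomial.eval_mul, Polynomial.eval_natCast, Polynomial.eval_X] at h
  have hM' : (0 : ℝ) < M := by exact_mod_cast hM
  have : (M : ℝ) * (tailB M).eval s ≤ M * (2 * s) := by
    calc (M : ℝ) * (tailB M).eval s
        = ∑ i ∈ Finset.Icc M (2 * M), (M : ℝ) * (bernsteinPolynomial ℝ (2 * M) i).eval s := by
          rw [tailB, Polynomial.eval_finsetSum, Finset.mul_sum]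
      _ ≤ ∑ i ∈ Finset.Icc M (2 * M), (i : ℝ) * (bernsteinPolynomial ℝ (2 * M) i).eval s := by
          refine Finset.sum_le_sum fun i hi => ?_
          have : (M : ℝ) ≤ i := by exact_mod_cast (Finset.mem_Icc.1 hi).1
          exact mul_le_mul_of_nonneg_right this (bern_nonneg _ _ _ h0 h1)
      _ ≤ ∑ i ∈ Finset.range (2 * M + 1),
            (i : ℝ) * (bernsteinPolynomial ℝ (2 * M) i).eval s := by
          refine Finset.sum_le_sum_of_subset_of_nonneg ?_ ?_
          · intro i hi; simp at hi ⊢; omega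
          · intro i _ _
            exact mul_nonneg (Nat.cast_nonneg _) (bern_nonneg _ _ _ h0 h1)
      _ = M * (2 * s) := by rw [h]; push_cast; ring
  exact le_of_mul_le_mul_left this hM'

lemma tail_chernoff (M : ℕ) (s : ℝ) (h0 : 5 / 9 ≤ s) (h1 : s ≤ 1) :
    1 - (tailB M).eval s ≤ (80 / 81) ^ M := by
  have h := tail_split M s
  have hs0 : 0 ≤ 1 - s := by linarith
  have hs1 : 0 ≤ s := by linarith
  have key : ∑ i ∈ Finset.range M, (bernsteinPolynomial ℝ (2 * M) i).eval s ≤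
      ∑ i ∈ Finset.range (2 * M + 1), ((2 * M).choose i : ℝ) * (s * (1 - s)) ^ M := by
    calc _ ≤ ∑ i ∈ Finset.range M, ((2 * M).choose i : ℝ) * (s * (1 - s)) ^ M := by
          refine Finset.sum_le_sum fun i hi => ?_
          have hi := Finset.mem_range.1 hi
          rw [bern_eval, mul_assoc]
          refine mul_le_mul_of_nonneg_left ?_ (Nat.cast_nonneg _)
          obtain ⟨d, rfl⟩ := Nat.exists_eq_add_of_lt hi
          have e : 2 * (i + d + 1) - i = (i + d + 1) + (d + 1) := by omega
          rw [e, mul_pow, pow_add (1 - s)]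
          have hh : (1 - s) ^ (d + 1) ≤ s ^ (d + 1) := pow_le_pow_left₀ hs0 (by linarith) _
          calc s ^ i * ((1 - s) ^ (i + d + 1) * (1 - s) ^ (d + 1))
              ≤ s ^ i * ((1 - s) ^ (i + d + 1) * s ^ (d + 1)) := by gcongr
            _ = _ := by ring
      _ ≤ _ := by
          refine Finset.sum_le_sum_of_subset_of_nonneg ?_ ?_
          · intro i hi; simp at hi ⊢; omega
          · intro i _ _; positivity
  rw [← Finset.sum_mul] at key
  have hc : ∑ i ∈ Finset.range (2 * M + 1), ((2 * M).choose i : ℝ) = 4 ^ M := by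
    have := Nat.sum_range_choose (2 * M)
    have h2 : (∑ i ∈ Finset.range (2 * M + 1), ((2 * M).choose i : ℝ)) = 2 ^ (2 * M) := by
      exact_mod_cast this
    rw [h2, pow_mul]; norm_num
  rw [hc, ← mul_pow] at key
  have : (4 * (s * (1 - s))) ^ M ≤ (80 / 81 : ℝ) ^ M :=
    pow_le_pow_left₀ (by positivity) (by nlinarith) _
  linarith

lemma tail_deg (M : ℕ) : (tailB M).natDegree ≤ 2 * M := by
  unfold tailB
  refine Polynomial.natDegree_sum_le_of_forall_le _ _ fun i hi => ?_
  have hi := (Finset.mem_Icc.1 hi).2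
  unfold bernsteinPolynomial
  have h1 : ((Polynomial.X : Polynomial ℝ) ^ i).natDegree ≤ i := by compute_degree
  have h2 : ((1 - Polynomial.X : Polynomial ℝ) ^ (2 * M - i)).natDegree ≤ (2 * M - i) * 1 :=
    Polynomial.natDegree_pow_le_of_le _ (by compute_degree)
  have h3 : (((2 * M).choose i : Polynomial ℝ)).natDegree ≤ 0 := by simp
  have h4 := Polynomial.natDegree_mul_le_of_le (Polynomial.natDegree_mul_le_of_le h3 h1) h2
  omega

set_option maxHeartbeats 1000000 in
open Polynomial in
/-- Polynomial approximation of `(3/4)·δ/x`: there is a constant `C > 0`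
such that for all `ε, δ ∈ (0, 1/2]` there is an odd real polynomial `p` of degree at most
`C · (1/δ) · log(1/ε)` with `|p(x) − (3/4)·δ/x| ≤ ε` whenever `δ ≤ |x| ≤ 1`, and
`|p(x)| ≤ 1` on `[−1, 1]`. -/
theorem stmt_3 :
    ∃ C : ℝ, 0 < C ∧
      ∀ ε δ : ℝ, ε ∈ Set.Ioc (0 : ℝ) (1 / 2) → δ ∈ Set.Ioc (0 : ℝ) (1 / 2) →
        ∃ p : Polynomial ℝ,
          (∀ x : ℝ, p.eval (-x) = - p.eval x) ∧
          (p.natDegree : ℝ) ≤ C * (1 / δ) * Real.log (1 / ε) ∧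
          (∀ x : ℝ, δ ≤ |x| → |x| ≤ 1 → |p.eval x - 3 / 4 * (δ / x)| ≤ ε) ∧
          (∀ x ∈ Set.Icc (-1 : ℝ) 1, |p.eval x| ≤ 1) := by
  refine ⟨1000, by norm_num, ?_⟩
  rintro ε δ ⟨hε0, hε1⟩ ⟨hδ0, hδ1⟩
  set L := Real.log (1 / ε) with hL
  have hL2 : 0.69 ≤ L := by
    have h1 : Real.log 2 ≤ L := by
      apply Real.log_le_log (by norm_num)
      rw [le_div_iff₀ hε0]; linarith
    have := Real.log_two_gt_d9
    linarith
  set M := ⌈81 * L⌉₊ with hM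
  have hM1 : 81 * L ≤ M := Nat.le_ceil _
  have hM2 : (M : ℝ) ≤ 83 * L := by
    have := Nat.ceil_lt_add_one (show 0 ≤ 81 * L by linarith)
    linarith
  have hMpos : 0 < M := Nat.ceil_pos.2 (by linarith)
  set m := ⌈3 / (4 * δ)⌉₊ with hm
  have hm1 : 3 / 4 ≤ m * δ := by
    have : 3 / (4 * δ) ≤ m := Nat.le_ceil _
    rw [div_le_iff₀ (by positivity)] at this
    linarith
  have hm2 : (m : ℝ) ≤ 5 / 4 * (1 / δ) := by
    have h1 := Nat.ceil_lt_add_one (show 0 ≤ 3 / (4 * δ) by positivity)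
    have h2 : 3 / (4 * δ) = 3 / 4 * (1 / δ) := by field_simp
    have h3 : 2 ≤ 1 / δ := by rw [le_div_iff₀ hδ0]; linarith
    rw [← hm] at h1
    linarith
  have hn : (0 : ℝ) < 2 * m + 1 := by positivity
  set lam := 3 / 2 / ((2 * m + 1) * δ) with hlam
  have hlam0 : 0 < lam := by positivity
  have hlam1 : lam ≤ 1 := by
    rw [hlam, div_le_one (by positivity)]; nlinarith
  have hlamx : ∀ x, (2 * m + 1) * (lam * x) = 3 / 2 * (x / δ) := by
    intro x; rw [hlam]; field_simp
  -- the polynomial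
  set S : ℝ[X] := 1 - ((dirG m).comp (C lam * X)) ^ 2 with hS
  set F : ℝ[X] := (tailB M).comp S with hF
  have hSe : ∀ x, S.eval x = 1 - (dirG m).eval (lam * x) ^ 2 := by intro x; simp [hS]
  have hFe : ∀ x, F.eval x = (tailB M).eval (S.eval x) := by intro x; simp [hF]
  have hlx : ∀ x, |x| ≤ 1 → |lam * x| ≤ 1 := by
    intro x hx
    rw [abs_mul, abs_of_pos hlam0]
    nlinarith [abs_nonneg x]
  have hS0 : ∀ x, |x| ≤ 1 → 0 ≤ S.eval x ∧ S.eval x ≤ 1 ∧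
      S.eval x ≤ 3 / 4 * (x / δ) ^ 2 ∧ (1 - S.eval x) * (9 / 4 * (x / δ) ^ 2) ≤ 1 := by
    intro x hx
    obtain ⟨h1, h2, h3⟩ := dirG_facts m (lam * x) (hlx x hx)
    rw [hlamx] at h2 h3
    rw [hSe]
    refine ⟨by linarith, by nlinarith, by nlinarith, by nlinarith⟩
  have hSz : S.eval 0 = 0 := by rw [hSe, mul_zero, dirG_zero]; ring
  have hFz : F.eval 0 = 0 := by
    rw [hFe, hSz]
    have h1 := tail_markov M hMpos 0 le_rfl zero_le_one
    have h2 := tail_nonneg M 0 le_rfl zero_le_one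
    linarith
  have hFev : ∀ x, F.eval (-x) = F.eval x := by
    intro x
    rw [hFe, hFe, hSe, hSe, mul_neg, dirG_even]
  set p : ℝ[X] := C (3 / 4 * δ) * F.divX with hp
  have hpX : ∀ x, x * p.eval x = 3 / 4 * δ * F.eval x := by
    intro x
    have h := congrArg (eval x) (divX_mul_X_add F)
    rw [coeff_zero_eq_eval_zero, hFz] at h
    simp only [eval_add, eval_mul, eval_X, eval_C] at h
    rw [hp, eval_mul, eval_C, ← h]; ring
  have hodd : p.comp (-X) + p = 0 := by
    have : X * (p.comp (-X) + p) = 0 := by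
      apply Polynomial.funext
      intro x
      have h1 := hpX x
      have h2 := hpX (-x)
      rw [hFev] at h2
      simp only [eval_mul, eval_X, eval_add, eval_comp, eval_neg, eval_zero]
      linarith
    exact (mul_eq_zero.1 this).resolve_left X_ne_zero
  have hodd' : ∀ x, p.eval (-x) = - p.eval x := by
    intro x
    have h := congrArg (eval x) hodd
    simp only [eval_add, eval_comp, eval_neg, eval_X, eval_zero] at h
    linarith
  have hF01 : ∀ x, |x| ≤ 1 → 0 ≤ F.eval x ∧ F.eval x ≤ 1 := by
    intro x hx
    obtain ⟨h1, h2, _⟩ := hS0 x hx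
    rw [hFe]
    exact ⟨tail_nonneg _ _ h1 h2, tail_le_one _ _ h1 h2⟩
  refine ⟨p, hodd', ?_, ?_, ?_⟩
  · have d1 : ((dirG m).comp (C lam * X)).natDegree ≤ 2 * m := by
      refine natDegree_comp_le.trans ?_
      have h1 : (C lam * X : ℝ[X]).natDegree ≤ 1 := by compute_degree
      calc _ ≤ (2 * m) * 1 := Nat.mul_le_mul (dirG_deg m) h1
        _ = _ := by ring
    have d2 : S.natDegree ≤ 2 * (2 * m) := by
      refine (natDegree_sub_le _ _).trans ?_
      refine max_le (by simp) (natDegree_pow_le_of_le _ d1)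
    have d3 : F.natDegree ≤ (2 * M) * (2 * (2 * m)) :=
      natDegree_comp_le.trans (Nat.mul_le_mul (tail_deg M) d2)
    have d4 : p.natDegree ≤ (2 * M) * (2 * (2 * m)) := by
      refine (natDegree_C_mul_le _ _).trans ?_
      rw [natDegree_divX_eq_natDegree_tsub_one]
      omega
    have d5 : (p.natDegree : ℝ) ≤ (2 * M) * (2 * (2 * m)) := by exact_mod_cast d4
    have h3 : 0 < 1 / δ := by positivity
    have : (M : ℝ) * m ≤ (83 * L) * (5 / 4 * (1 / δ)) := by gcongr
    have : 0 ≤ 1 / δ * L := by positivity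
    nlinarith
  · intro x hx1 hx2
    have hx0 : 0 < |x| := by linarith
    have hxne : x ≠ 0 := abs_pos.1 hx0
    obtain ⟨h1, h2, h3, h4⟩ := hS0 x hx2
    have hu : 1 ≤ (x / δ) ^ 2 := by
      rw [div_pow, one_le_div (by positivity), ← sq_abs x]
      exact pow_le_pow_left₀ hδ0.le hx1 2
    have hs : 5 / 9 ≤ S.eval x := by nlinarith
    have hc := tail_chernoff M _ hs h2
    rw [← hFe] at hc
    have hpow : (80 / 81 : ℝ) ^ M ≤ ε := by
      have h5 : (80 / 81 : ℝ) ≤ Real.exp (-(1 / 81)) := by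
        have := Real.add_one_le_exp (-(1 / 81) : ℝ)
        linarith
      calc (80 / 81 : ℝ) ^ M ≤ Real.exp (-(1 / 81)) ^ M := pow_le_pow_left₀ (by norm_num) h5 _
        _ = Real.exp (M * (-(1 / 81))) := by rw [Real.exp_nat_mul]
        _ ≤ Real.exp (-L) := Real.exp_le_exp.2 (by linarith)
        _ = ε := by rw [hL, one_div, Real.log_inv, neg_neg, Real.exp_log hε0]
    have hpe : p.eval x - 3 / 4 * (δ / x) = -(3 / 4 * (δ / x) * (1 - F.eval x)) := by
      have := hpX x
      field_simp
      linarith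
    obtain ⟨f0, f1⟩ := hF01 x hx2
    rw [hpe, abs_neg, abs_mul, abs_mul, abs_div δ x, abs_of_pos hδ0,
      abs_of_nonneg (show 0 ≤ 1 - F.eval x by linarith),
      abs_of_pos (show (0 : ℝ) < 3 / 4 by norm_num)]
    have hd : δ / |x| ≤ 1 := (div_le_one hx0).2 hx1
    have hd0 : 0 ≤ δ / |x| := by positivity
    nlinarith
  · intro x hx
    have hx2 : |x| ≤ 1 := abs_le.2 hx
    by_cases hxne : x = 0
    · have h := hodd' 0
      rw [neg_zero] at h
      have : p.eval 0 = 0 := by linarith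
      rw [hxne, this]; simp
    have hx0 : 0 < |x| := abs_pos.2 hxne
    obtain ⟨h1, h2, h3, h4⟩ := hS0 x hx2
    obtain ⟨f0, f1⟩ := hF01 x hx2
    have hmk := tail_markov M hMpos _ h1 h2
    rw [← hFe] at hmk
    have hb : 3 / 4 * δ * F.eval x ≤ |x| := by
      rcases le_or_gt (3 / 4 * δ) |x| with h | h
      · nlinarith
      · have e : (x / δ) ^ 2 = (|x| / δ) ^ 2 := by rw [div_pow, div_pow, sq_abs]
        rw [e] at h3
        set u := |x| / δ with hu
        have hxu : |x| = u * δ := by rw [hu, div_mul_cancel₀ _ hδ0.ne']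
        have hu0 : 0 < u := by positivity
        have hu1 : u < 3 / 4 := by
          rw [hu, div_lt_iff₀ hδ0]; exact h
        have : 3 / 4 * F.eval x ≤ u := by nlinarith
        rw [hxu]; nlinarith
    have habs : |x| * |p.eval x| = 3 / 4 * δ * F.eval x := by
      rw [← abs_mul, hpX, abs_of_nonneg (by positivity)]
    have : |x| * |p.eval x| ≤ |x| * 1 := by linarith
    exact le_of_mul_le_mul_left this hx0
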